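/- The maximum softmax confidence is antitone in the temperature (Appendix B.2): if j* ∈ ι satisfies z_{j*} = max_{k ∈ ι} z_k, then the map T ↦ p^{(T)}_{j*}(z) is antitone on (0, ∞); that is, for all 0 < T₁ ≤ T₂ one has p^{(T₂)}_{j*}(z) ≤ p^{(T₁)}_{j*}(z). -/

import Mathlib

open Real

/-- Temperature-scaled softmax probability: `p^{(T)}_j(z) = exp(z j / T) / ∑ k, exp(z k / T)`. -/
noncomputable def tempSoftmax {ι : Type*} [Fintype ι] (z : ι → ℝ) (T : ℝ) (j : ι) : ℝ :=
  Real.exp (z j / T) / ∑ k, Real.exp (z k / T)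

/-- **The maximum softmax confidence is antitone in the temperature**: if `j*` attains
the maximal logit, then `T ↦ p^{(T)}_{j*}(z)` is antitone on `(0, ∞)`: for all
`0 < T₁ ≤ T₂`, `p^{(T₂)}_{j*}(z) ≤ p^{(T₁)}_{j*}(z)`. -/
theorem tempSoftmax_max_antitoneOn
    {ι : Type*} [Fintype ι] [Nonempty ι] (z : ι → ℝ) (jstar : ι)
    (hmax : ∀ k, z k ≤ z jstar) :
    AntitoneOn (fun T : ℝ => tempSoftmax z T jstar) (Set.Ioi 0) := by
  intro T₁ (hT₁ : 0 < T₁) T₂ _ hT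
  have sum_pos (T : ℝ) : 0 < ∑ k, Real.exp (z k / T) :=
    Finset.sum_pos (fun k _ => Real.exp_pos _) Finset.univ_nonempty
  simp only [tempSoftmax]
  rw [div_le_div_iff₀ (sum_pos T₂) (sum_pos T₁), Finset.mul_sum, Finset.mul_sum]
  refine Finset.sum_le_sum fun k _ => ?_
  rw [← Real.exp_add, ← Real.exp_add, Real.exp_le_exp]
  have hgap : (z jstar - z k) / T₂ ≤ (z jstar - z k) / T₁ :=
    div_le_div_of_nonneg_left (sub_nonneg.2 (hmax k)) hT₁ hT
  rw [sub_div, sub_div] at hgap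
  linarith
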